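/- arXiv:0803.4261 — 8 statements merged into one kernel-verified Lean document; each statement's English description precedes it below -/
import Mathlib

section
/- Let P and N be strings over an alphabet Σ such that no symbol occurring in P occurs in N. Then no common subsequence of the two strings P·N and N·P (concatenations) contains both a symbol occurring in P and a symbol occurring in N. -/
/-- If no symbol occurring in `P` occurs in `N`, then no common
subsequence of `P ++ N` and `N ++ P` contains both a symbol occurring in `P` and a
symbol occurring in `N`. -/
theorem no_common_subseq_mixing {σ : Type*} (P N : List σ)
    (hPN : ∀ s ∈ P, s ∉ N)
    (c : List σ) (hc1 : c.Sublist (P ++ N)) (hc2 : c.Sublist (N ++ P)) :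
    ¬ ((∃ s ∈ c, s ∈ P) ∧ (∃ s ∈ c, s ∈ N)) := by
  rintro ⟨⟨s, hsc, hsP⟩, ⟨t, htc, htN⟩⟩
  obtain ⟨a, b, rfl, ha, hb⟩ := List.sublist_append_iff.mp hc1
  obtain ⟨d, e, h, hd, he⟩ := List.sublist_append_iff.mp hc2
  rcases List.append_eq_append_iff.mp h with ⟨x, rfl, rfl⟩ | ⟨x, rfl, rfl⟩
  · refine hPN s hsP ?_
    rcases List.mem_append.mp hsc with hs | hs
    · exact hd.subset (List.mem_append_left x hs)
    · exact hb.subset hs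
  · refine hPN t ?_ htN
    rcases List.mem_append.mp htc with ht | ht
    · exact ha.subset ht
    · exact he.subset (List.mem_append_right x ht)
end

section
/- Let x, y, z, x̄, ȳ, z̄ be six pairwise distinct symbols, and consider the strings A = x y z x̄ ȳ z̄ and B = x y z ȳ x̄ z̄ ȳ. For every nonempty subset S ⊆ {x, y, z}, there exists a common subsequence of A and B with no repeated symbols that, for each of the three coordinates, contains the positive symbol (x, y, or z) if that coordinate is in S and the barred symbol (x̄, ȳ, or z̄) if it is not. (That is, all seven of the three-symbol combinations other than {x̄, ȳ, z̄} can be simultaneously aligned inside the block.) -/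
/-- For six pairwise distinct symbols and the strings
`A = x y z x̄ ȳ z̄`, `B = x y z ȳ x̄ z̄ ȳ`: for every nonempty subset `S` of the three
coordinates (encoded as `S : Fin 3 → Bool`, not identically `false`), there is a common
subsequence of `A` and `B` with no repeated symbols which contains, in each coordinate,
the positive symbol if that coordinate lies in `S` and the barred symbol otherwise. -/
theorem clause_block_admits_all_satisfying {σ : Type*} (x y z xb yb zb : σ)
    (hdist : ([x, y, z, xb, yb, zb] : List σ).Nodup)
    (S : Fin 3 → Bool) (hS : ∃ k, S k = true) :
    ∃ c : List σ,
      c.Sublist [x, y, z, xb, yb, zb] ∧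
      c.Sublist [x, y, z, yb, xb, zb, yb] ∧
      c.Nodup ∧
      (if S 0 = true then x else xb) ∈ c ∧
      (if S 1 = true then y else yb) ∈ c ∧
      (if S 2 = true then z else zb) ∈ c := by
  suffices h : ∃ c : List σ,
      c.Sublist [x, y, z, xb, yb, zb] ∧
      c.Sublist [x, y, z, yb, xb, zb, yb] ∧
      (if S 0 = true then x else xb) ∈ c ∧
      (if S 1 = true then y else yb) ∈ c ∧
      (if S 2 = true then z else zb) ∈ c by
    obtain ⟨c, hA, hB, hmem⟩ := h
    exact ⟨c, hA, hB, hdist.sublist hA, hmem⟩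
  have hS' : S 0 = true ∨ S 1 = true ∨ S 2 = true := by
    simpa [Fin.exists_fin_succ] using hS
  cases h0 : S 0 <;> cases h1 : S 1 <;> cases h2 : S 2
  · simp [h0, h1, h2] at hS'
  on_goal 1 => refine ⟨[z, xb, yb], ?_, ?_, by simp⟩
  on_goal 3 => refine ⟨[y, xb, zb], ?_, ?_, by simp⟩
  on_goal 5 => refine ⟨[y, z, xb], ?_, ?_, by simp⟩
  on_goal 7 => refine ⟨[x, yb, zb], ?_, ?_, by simp⟩
  on_goal 9 => refine ⟨[x, z, yb], ?_, ?_, by simp⟩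
  on_goal 11 => refine ⟨[x, y, zb], ?_, ?_, by simp⟩
  on_goal 13 => refine ⟨[x, y, z], ?_, ?_, by simp⟩
  all_goals
    repeat first
      | exact List.Sublist.slnil
      | apply List.Sublist.cons_cons
      | apply List.Sublist.cons
end

section
/- Let a = A₁·A₂·⋯·A_k and b = B₁·B₂·⋯·B_k be concatenations of strings over an alphabet Σ, and suppose there are pairwise disjoint sets S₁,…,S_k ⊆ Σ such that every symbol occurring in A_j or in B_j belongs to S_j, for each j. Then every common subsequence c of a and b decomposes as a concatenation c = c₁·c₂·⋯·c_k where, for each j, c_j is a common subsequence of A_j and B_j and every symbol occurring in c_j belongs to S_j. -/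
theorem exists_eq_flatten_ofFn_of_sublist {σ : Type*} {k : ℕ} (A : Fin k → List σ)
    {c : List σ} (h : c.Sublist (List.ofFn A).flatten) :
    ∃ cs : Fin k → List σ, c = (List.ofFn cs).flatten ∧ ∀ j, (cs j).Sublist (A j) := by
  induction k generalizing c with
  | zero => exact ⟨A, by simpa using h, fun j => j.elim0⟩
  | succ k ih =>
    rw [List.ofFn_succ, List.flatten_cons, List.sublist_append_iff] at h
    obtain ⟨l₁, l₂, rfl, h₁, h₂⟩ := h
    obtain ⟨cs, rfl, hcs⟩ := ih (fun i => A i.succ) h₂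
    exact ⟨Fin.cons l₁ cs, by simp [List.ofFn_succ], Fin.cases h₁ hcs⟩

open Classical in
theorem filter_mem_flatten_ofFn {σ : Type*} {k : ℕ} {S : Fin k → Set σ}
    (hdisj : ∀ j j' : Fin k, j ≠ j' → Disjoint (S j) (S j'))
    {L : Fin k → List σ} (hL : ∀ j, ∀ s ∈ L j, s ∈ S j) (j : Fin k) :
    (List.ofFn L).flatten.filter (· ∈ S j) = L j := by
  have filter_block (i : Fin k) : (L i).filter (· ∈ S j) = if i = j then L j else [] := by
    split_ifs with hij
    · subst hij
      exact List.filter_eq_self.2 fun s hs => by simpa using hL i s hs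
    · refine List.filter_eq_nil_iff.2 fun s hs => ?_
      simpa using Set.disjoint_left.1 (hdisj i j hij) (hL i s hs)
  have flatten_single {n : ℕ} (i : Fin n) (l : List σ) :
      (List.ofFn fun m => if m = i then l else []).flatten = l := by
    induction n with
    | zero => exact i.elim0
    | succ n ih =>
      refine Fin.cases ?_ (fun i => ?_) i
      · simp [List.ofFn_succ, Fin.succ_ne_zero]
      · simpa [List.ofFn_succ, (Fin.succ_ne_zero i).symm] using ih i
  rw [List.filter_flatten, List.map_ofFn]
  simpa only [Function.comp_def, filter_block] using flatten_single j (L j)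


/-- Let `a = A₁ · ⋯ · A_k` and `b = B₁ · ⋯ · B_k` where all symbols of
`A_j` and `B_j` lie in `S j`, for pairwise disjoint sets `S₁, …, S_k`. Then every common
subsequence `c` of `a` and `b` decomposes as `c = c₁ · ⋯ · c_k` where each `c_j` is a
common subsequence of `A_j` and `B_j` all of whose symbols lie in `S j`. -/
theorem common_subseq_decomposes_along_disjoint_blocks {σ : Type*} (k : ℕ)
    (A B : Fin k → List σ) (S : Fin k → Set σ)
    (hdisj : ∀ j j' : Fin k, j ≠ j' → Disjoint (S j) (S j'))
    (hA : ∀ j, ∀ s ∈ A j, s ∈ S j) (hB : ∀ j, ∀ s ∈ B j, s ∈ S j)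
    (c : List σ)
    (hca : c.Sublist (List.ofFn A).flatten) (hcb : c.Sublist (List.ofFn B).flatten) :
    ∃ cs : Fin k → List σ,
      c = (List.ofFn cs).flatten ∧
      ∀ j, (cs j).Sublist (A j) ∧ (cs j).Sublist (B j) ∧ ∀ s ∈ cs j, s ∈ S j := by
  obtain ⟨as, rfl, has⟩ := exists_eq_flatten_ofFn_of_sublist A hca
  obtain ⟨bs, hab, hbs⟩ := exists_eq_flatten_ofFn_of_sublist B hcb
  have has_mem (j) : ∀ s ∈ as j, s ∈ S j := fun s hs => hA j s ((has j).subset hs)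
  have hbs_mem (j) : ∀ s ∈ bs j, s ∈ S j := fun s hs => hB j s ((hbs j).subset hs)
  refine ⟨as, rfl, fun j => ⟨has j, ?_, has_mem j⟩⟩
  rw [← filter_mem_flatten_ofFn hdisj has_mem j, hab,
    filter_mem_flatten_ofFn hdisj hbs_mem j]
  exact hbs j
end

section
/- Let U be a finite set of Boolean variables and C = {c₁,…,c_n} a collection of clauses over U with exactly three literals per clause. Let Σ consist of a boundary symbol • together with symbols u^i and ū^i for every variable u ∈ U and every index i such that u or ¬u appears in clause c_i. Define strings a and b over Σ as follows. For each variable u with clause indices i₁ < ⋯ < i_m, string a contains the truth-setting block u^{i₁}⋯u^{i_m} ū^{i₁}⋯ū^{i_m} and string b contains the block ū^{i₁}⋯ū^{i_m} u^{i₁}⋯u^{i_m}; these variable blocks are concatenated (in the same variable order in a and b), followed in both strings by the symbol •, followed by clause blocks: for each clause c_i = {x,y,z} (where for a positive literal x = u one sets x^i = u^i and x̄^i = ū^i, and for a negative literal x = ¬u one sets x^i = ū^i and x̄^i = u^i), string a contains the block x^i y^i z^i x̄^i ȳ^i z̄^i and string b contains the block x^i y^i z^i ȳ^i x̄^i z̄^i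 ȳ^i, concatenated in the same clause order. If there exists a satisfying truth assignment for C, then there exists a permutation of Σ that is a common subsequence of a and b. -/
namespace CommonPerm

/-! ## The reduction from 3SAT to Common Permutation -/

/-- A literal over variables `Fin m`: a variable together with a sign
(`true` = positive literal `u`, `false` = negated literal `¬u`). -/
abbrev Lit (m : ℕ) := Fin m × Bool

/-- A 3-clause: an (ordered) triple of literals `(x, y, z)`. -/
abbrev Clause (m : ℕ) := Lit m × Lit m × Lit m

/-- The symbols of the alphabet `Σ`: `none` is the boundary symbol `•`, and
`some (u, i, true)` (resp. `some (u, i, false)`) is the symbol `u^i` (resp. `ū^i`). -/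
abbrev Symb (m n : ℕ) := Option (Fin m × Fin n × Bool)

/-- The variable `u` occurs (positively or negatively) in clause `C i`. -/
abbrev OccursIn {m n : ℕ} (C : Fin n → Clause m) (u : Fin m) (i : Fin n) : Prop :=
  (C i).1.1 = u ∨ (C i).2.1.1 = u ∨ (C i).2.2.1 = u

/-- Membership in the alphabet `Σ`: the boundary symbol, together with `u^i`, `ū^i`
for every variable `u` and every clause `c_i` in which `u` appears. -/
def InSigma {m n : ℕ} (C : Fin n → Clause m) : Symb m n → Prop
  | none => True
  | some (u, i, _) => OccursIn C u i

instance {m n : ℕ} (C : Fin n → Clause m) : DecidablePred (InSigma C) := fun s =>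
  match s with
  | none => .isTrue trivial
  | some (_, _, _) => inferInstanceAs (Decidable (_ ∨ _ ∨ _))

/-- The indices `i₁ < ⋯ < i_m` of the clauses in which the variable `u` appears. -/
def clausesOf {m n : ℕ} (C : Fin n → Clause m) (u : Fin m) : List (Fin n) :=
  (List.finRange n).filter fun i => decide (OccursIn C u i)

/-- The truth-setting block of the string `a` for the variable `u`:
`u^{i₁} ⋯ u^{i_m} ū^{i₁} ⋯ ū^{i_m}`. -/
def vblockA {m n : ℕ} (C : Fin n → Clause m) (u : Fin m) : List (Symb m n) :=
  ((clausesOf C u).map fun i => some (u, i, true)) ++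
    ((clausesOf C u).map fun i => some (u, i, false))

/-- The truth-setting block of the string `b` for the variable `u`:
`ū^{i₁} ⋯ ū^{i_m} u^{i₁} ⋯ u^{i_m}`. -/
def vblockB {m n : ℕ} (C : Fin n → Clause m) (u : Fin m) : List (Symb m n) :=
  ((clausesOf C u).map fun i => some (u, i, false)) ++
    ((clausesOf C u).map fun i => some (u, i, true))

/-- For a literal `x` of clause `c_i`, the symbol `x^i` (i.e. `u^i` if `x = u`
is positive, and `ū^i` if `x = ¬u`). -/
def litSym {m n : ℕ} (i : Fin n) (l : Lit m) : Symb m n := some (l.1, i, l.2)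

/-- For a literal `x` of clause `c_i`, the symbol `x̄^i` (i.e. `ū^i` if `x = u`
is positive, and `u^i` if `x = ¬u`). -/
def litSymBar {m n : ℕ} (i : Fin n) (l : Lit m) : Symb m n := some (l.1, i, !l.2)

/-- The satisfaction-testing block of `a` for clause `c_i = {x, y, z}`:
`x^i y^i z^i x̄^i ȳ^i z̄^i`. -/
def cblockA {m n : ℕ} (C : Fin n → Clause m) (i : Fin n) : List (Symb m n) :=
  [litSym i (C i).1, litSym i (C i).2.1, litSym i (C i).2.2,
   litSymBar i (C i).1, litSymBar i (C i).2.1, litSymBar i (C i).2.2]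

/-- The satisfaction-testing block of `b` for clause `c_i = {x, y, z}`:
`x^i y^i z^i ȳ^i x̄^i z̄^i ȳ^i`. -/
def cblockB {m n : ℕ} (C : Fin n → Clause m) (i : Fin n) : List (Symb m n) :=
  [litSym i (C i).1, litSym i (C i).2.1, litSym i (C i).2.2,
   litSymBar i (C i).2.1, litSymBar i (C i).1, litSymBar i (C i).2.2,
   litSymBar i (C i).2.1]

/-- The truth-setting part of the string `a`. -/
def truthA {m n : ℕ} (C : Fin n → Clause m) : List (Symb m n) :=
  ((List.finRange m).map (vblockA C)).flatten

/-- The truth-setting part of the string `b`. -/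
def truthB {m n : ℕ} (C : Fin n → Clause m) : List (Symb m n) :=
  ((List.finRange m).map (vblockB C)).flatten

/-- The satisfaction-testing part of the string `a`. -/
def testA {m n : ℕ} (C : Fin n → Clause m) : List (Symb m n) :=
  ((List.finRange n).map (cblockA C)).flatten

/-- The satisfaction-testing part of the string `b`. -/
def testB {m n : ℕ} (C : Fin n → Clause m) : List (Symb m n) :=
  ((List.finRange n).map (cblockB C)).flatten

/-- The string `a` of the reduction. -/
def strA {m n : ℕ} (C : Fin n → Clause m) : List (Symb m n) :=
  truthA C ++ [none] ++ testA C

/-- The string `b` of the reduction. -/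
def strB {m n : ℕ} (C : Fin n → Clause m) : List (Symb m n) :=
  truthB C ++ [none] ++ testB C

/-- The three literals of each clause involve three pairwise distinct variables
(`c_i` is a set of exactly three literals). -/
def ThreeDistinct {m n : ℕ} (C : Fin n → Clause m) : Prop :=
  ∀ i, (C i).1.1 ≠ (C i).2.1.1 ∧ (C i).1.1 ≠ (C i).2.2.1 ∧ (C i).2.1.1 ≠ (C i).2.2.1

/-- The literal `l` is true under the truth assignment `t`. -/
def LitTrue {m : ℕ} (t : Fin m → Bool) (l : Lit m) : Prop := t l.1 = l.2

/-- The truth assignment `t` satisfies every clause of `C`. -/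
def Satisfies {m n : ℕ} (t : Fin m → Bool) (C : Fin n → Clause m) : Prop :=
  ∀ i, LitTrue t (C i).1 ∨ LitTrue t (C i).2.1 ∨ LitTrue t (C i).2.2

/-- `p` is a permutation of the alphabet `Σ`: a string containing every symbol of `Σ`
exactly once. -/
def IsPermOfSigma {m n : ℕ} (C : Fin n → Clause m) (p : List (Symb m n)) : Prop :=
  p.Nodup ∧ ∀ s, s ∈ p ↔ InSigma C s

/-- The symbol `s` spells a literal that is true under `t` (the boundary symbol counts
as false). -/
def symTrue {m n : ℕ} (t : Fin m → Bool) : Symb m n → Bool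
  | none => false
  | some (u, _, b) => t u == b

/-- The symbols of the variable `u` that are false under `t`, in increasing clause order. -/
def falseBlock {m n : ℕ} (C : Fin n → Clause m) (t : Fin m → Bool) (u : Fin m) :
    List (Symb m n) :=
  (clausesOf C u).map fun i => some (u, i, !t u)

/-- The symbols of the clause `c_i` that are true under `t`, in the order of `cblockA`. -/
def trueBlock {m n : ℕ} (C : Fin n → Clause m) (t : Fin m → Bool) (i : Fin n) :
    List (Symb m n) :=
  (cblockA C i).filter (symTrue t)

/-- All false symbols, grouped by variable. -/
def falsePart {m n : ℕ} (C : Fin n → Clause m) (t : Fin m → Bool) : List (Symb m n) :=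
  ((List.finRange m).map (falseBlock C t)).flatten

/-- All true symbols, grouped by clause. -/
def truePart {m n : ℕ} (C : Fin n → Clause m) (t : Fin m → Bool) : List (Symb m n) :=
  ((List.finRange n).map (trueBlock C t)).flatten

theorem sublist_flatten_map {α β : Type*} (l : List α) {f g : α → List β}
    (h : ∀ x, (f x).Sublist (g x)) : ((l.map f).flatten).Sublist ((l.map g).flatten) := by
  induction l with
  | nil => simp
  | cons x l ih => simpa using (h x).append ih

theorem filter_sublist_of_clause {α : Type*} (p : α → Bool) {x y z x' y' z' : α}
    (hx : p x' = !p x) (hy : p y' = !p y) (hz : p z' = !p z)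
    (h : p x = true ∨ p y = true ∨ p z = true) :
    ([x, y, z, x', y', z'].filter p).Sublist [x, y, z, y', x', z', y'] := by
  simp only [List.filter_cons, List.filter_nil, hx, hy, hz]
  generalize p x = a at h
  generalize p y = b at h
  generalize p z = c at h
  cases a <;> cases b <;> cases c <;> simp at h <;>
    simp only [Bool.not_true, Bool.not_false, Bool.false_eq_true, if_true, if_false] <;>
    repeat first
      | exact List.nil_sublist _
      | apply List.Sublist.cons_cons
      | apply List.Sublist.cons

section

variable {m n : ℕ} (C : Fin n → Clause m) (t : Fin m → Bool)

theorem mem_clausesOf (u : Fin m) (i : Fin n) : i ∈ clausesOf C u ↔ OccursIn C u i := by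
  simp [clausesOf]

theorem falseBlock_sublist_vblockA (u : Fin m) : (falseBlock C t u).Sublist (vblockA C u) := by
  unfold falseBlock vblockA
  cases t u
  · exact List.sublist_append_left _ _
  · exact List.sublist_append_right _ _

theorem falseBlock_sublist_vblockB (u : Fin m) : (falseBlock C t u).Sublist (vblockB C u) := by
  unfold falseBlock vblockB
  cases t u
  · exact List.sublist_append_right _ _
  · exact List.sublist_append_left _ _

theorem trueBlock_sublist_cblockB (ht : Satisfies t C) (i : Fin n) :
    (trueBlock C t i).Sublist (cblockB C i) := by
  have symTrue_litSymBar (l : Lit m) :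
      symTrue t (litSymBar i l) = !symTrue t (litSym i l) := by
    simp only [symTrue, litSym, litSymBar]
    cases t l.1 <;> cases l.2 <;> rfl
  refine filter_sublist_of_clause _ (symTrue_litSymBar _) (symTrue_litSymBar _)
    (symTrue_litSymBar _) ?_
  simpa [symTrue, litSym, LitTrue] using ht i

theorem mem_cblockA (i j : Fin n) (u : Fin m) (b : Bool) :
    some (u, j, b) ∈ cblockA C i ↔ j = i ∧ OccursIn C u i := by
  simp only [cblockA, litSym, litSymBar, OccursIn]
  generalize C i = c
  obtain ⟨⟨x, tx⟩, ⟨y, ty⟩, ⟨z, tz⟩⟩ := c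
  cases b <;> cases tx <;> cases ty <;> cases tz <;> simp <;> grind

theorem nodup_cblockA (hC : ThreeDistinct C) (i : Fin n) : (cblockA C i).Nodup := by
  have h := hC i
  unfold cblockA
  generalize C i = c at h ⊢
  obtain ⟨⟨x, tx⟩, ⟨y, ty⟩, ⟨z, tz⟩⟩ := c
  simp only at h
  simp [litSym, litSymBar, h, h.1.symm, h.2.1.symm, h.2.2.symm]

theorem none_notMem_falsePart : none ∉ falsePart C t := by
  simp [falsePart, falseBlock]

theorem none_notMem_truePart : none ∉ truePart C t := by
  simp [truePart, trueBlock, symTrue]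

theorem mem_falsePart (u : Fin m) (i : Fin n) (b : Bool) :
    some (u, i, b) ∈ falsePart C t ↔ OccursIn C u i ∧ b = !t u := by
  simp only [falsePart, falseBlock, List.mem_flatten, List.mem_map, List.mem_finRange]
  constructor
  · rintro ⟨_, ⟨v, -, rfl⟩, h⟩
    simp only [List.mem_map, Option.some.injEq, Prod.mk.injEq] at h
    obtain ⟨j, hj, rfl, rfl, rfl⟩ := h
    exact ⟨(mem_clausesOf C _ _).1 hj, rfl⟩
  · rintro ⟨h, rfl⟩
    exact ⟨_, ⟨u, trivial, rfl⟩, List.mem_map.2 ⟨i, (mem_clausesOf C _ _).2 h, rfl⟩⟩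

theorem mem_truePart (u : Fin m) (i : Fin n) (b : Bool) :
    some (u, i, b) ∈ truePart C t ↔ OccursIn C u i ∧ b = t u := by
  simp only [truePart, trueBlock, List.mem_flatten, List.mem_map, List.mem_finRange]
  constructor
  · rintro ⟨_, ⟨j, -, rfl⟩, h⟩
    rw [List.mem_filter, mem_cblockA] at h
    obtain ⟨⟨rfl, h⟩, hb⟩ := h
    exact ⟨h, (beq_iff_eq.1 hb).symm⟩
  · rintro ⟨h, rfl⟩
    exact ⟨_, ⟨i, trivial, rfl⟩,
      List.mem_filter.2 ⟨(mem_cblockA C _ _ _ _).2 ⟨rfl, h⟩, beq_self_eq_true _⟩⟩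

theorem nodup_falsePart : (falsePart C t).Nodup := by
  rw [falsePart, List.nodup_flatten]
  constructor
  · simp only [List.mem_map]
    rintro _ ⟨u, -, rfl⟩
    refine List.Nodup.map (fun i j h => ?_) ((List.nodup_finRange n).filter _)
    simpa using h
  · rw [List.pairwise_map]
    refine (List.nodup_finRange m).imp fun {u v} huv s hs hs' => ?_
    simp only [falseBlock, List.mem_map] at hs hs'
    obtain ⟨i, -, rfl⟩ := hs
    obtain ⟨j, -, h⟩ := hs'
    simp only [Option.some.injEq, Prod.mk.injEq] at h
    exact huv h.1.symm

theorem nodup_truePart (hC : ThreeDistinct C) : (truePart C t).Nodup := by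
  rw [truePart, List.nodup_flatten]
  constructor
  · simp only [List.mem_map]
    rintro _ ⟨i, -, rfl⟩
    exact (nodup_cblockA C hC i).filter _
  · rw [List.pairwise_map]
    refine (List.nodup_finRange n).imp fun {i j} hij s hs hs' => ?_
    rw [trueBlock, List.mem_filter] at hs hs'
    match s with
    | none => simp [symTrue] at hs
    | some (u, k, b) =>
      exact hij (((mem_cblockA C _ _ _ _).1 hs.1).1.symm.trans ((mem_cblockA C _ _ _ _).1 hs'.1).1)

theorem isPermOfSigma_falsePart_append_truePart (hC : ThreeDistinct C) :
    IsPermOfSigma C (falsePart C t ++ [none] ++ truePart C t) := by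
  constructor
  · rw [List.append_assoc, List.nodup_append', List.singleton_append, List.nodup_cons]
    refine ⟨nodup_falsePart C t, ⟨none_notMem_truePart C t, nodup_truePart C t hC⟩,
      fun s hs hs' => ?_⟩
    match s with
    | none => exact none_notMem_falsePart C t hs
    | some (u, i, b) =>
      have h := ((mem_falsePart C t u i b).1 hs).2
      have h' := ((mem_truePart C t u i b).1 (by simpa using hs')).2
      simp [h] at h'
  · rintro (_ | ⟨u, i, b⟩)
    · simp [InSigma]
    · simp only [List.mem_append, List.mem_singleton, mem_falsePart, mem_truePart, InSigma,
        reduceCtorEq, or_false, ← and_or_left, and_iff_left_iff_imp]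
      intro _
      cases b <;> cases t u <;> simp

end

/-- first direction of Theorem 2 of the paper.
If the 3SAT instance `C` (with exactly three literals, on pairwise distinct variables,
per clause) has a satisfying truth assignment, then there exists a permutation of the
alphabet `Σ` of the reduction which is a common subsequence of the constructed strings
`a` and `b`. -/
theorem satisfiable_implies_common_permutation (m n : ℕ) (C : Fin n → Clause m)
    (hC : ThreeDistinct C) (hsat : ∃ t : Fin m → Bool, Satisfies t C) :
    ∃ p : List (Symb m n),
      IsPermOfSigma C p ∧ p.Sublist (strA C) ∧ p.Sublist (strB C) := by
  obtain ⟨t, ht⟩ := hsat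
  refine ⟨falsePart C t ++ [none] ++ truePart C t,
    isPermOfSigma_falsePart_append_truePart C t hC, ?_, ?_⟩
  · exact ((sublist_flatten_map _ (falseBlock_sublist_vblockA C t)).append
      (List.Sublist.refl _)).append (sublist_flatten_map _ fun _ => List.filter_sublist)
  · exact ((sublist_flatten_map _ (falseBlock_sublist_vblockB C t)).append
      (List.Sublist.refl _)).append (sublist_flatten_map _ (trueBlock_sublist_cblockB C t ht))

end CommonPerm
end

section
/- Let U be a finite set of Boolean variables and C = {c₁,…,c_n} a collection of clauses over U with exactly three literals per clause. Let Σ consist of a boundary symbol • together with symbols u^i and ū^i for every variable u ∈ U and every index i such that u or ¬u appears in clause c_i. Define strings a and b over Σ as follows. For each variable u with clause indices i₁ < ⋯ < i_m, string a contains the truth-setting block u^{i₁}⋯u^{i_m} ū^{i₁}⋯ū^{i_m} and string b contains the block ū^{i₁}⋯ū^{i_m} u^{i₁}⋯u^{i_m}; these variable blocks are concatenated (in the same variable order in a and b), followed in both strings by the symbol •, followed by clause blocks: for each clause c_i = {x,y,z} (where for a positive literal x = u one sets x^i = u^i and x̄^i = ū^i, and for a negative literal x = ¬u one sets x^i = ū^i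 and x̄^i = u^i), string a contains the block x^i y^i z^i x̄^i ȳ^i z̄^i and string b contains the block x^i y^i z^i ȳ^i x̄^i z̄^i ȳ^i, concatenated in the same clause order. If there exists a permutation of Σ that is a common subsequence of a and b, then there exists a satisfying truth assignment for C. -/
namespace CommonPerm

/-- A sublist relation between lists split at a symbol `x` splits, provided `x` occurs only once
in the larger list. -/
theorem sublist_split {α : Type*} {x : α} {q r A B : List α} (hA : x ∉ A) (hB : x ∉ B)
    (h : (q ++ x :: r).Sublist (A ++ x :: B)) : q.Sublist A ∧ r.Sublist B := by
  obtain ⟨l₁, l₂, he, h₁, h₂⟩ := List.sublist_append_iff.1 h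
  rcases List.append_eq_append_iff.1 he with ⟨d, hd₁, hd₂⟩ | ⟨d, hd₁, hd₂⟩
  · cases d with
    | nil =>
      simp only [List.append_nil, List.nil_append] at hd₁ hd₂
      subst hd₁ hd₂
      exact ⟨h₁, List.cons_sublist_cons.1 h₂⟩
    | cons y d =>
      simp only [List.cons_append, List.cons.injEq] at hd₂
      exact absurd (h₁.subset (by simp [hd₁, hd₂.1])) hA
  · cases d with
    | nil =>
      simp only [List.append_nil, List.nil_append] at hd₁ hd₂
      subst hd₁ hd₂
      exact ⟨h₁, List.cons_sublist_cons.1 h₂⟩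
    | cons y d =>
      subst hd₂
      rw [List.cons_append] at h₂
      have h₃ : (d ++ x :: r).Sublist B := h₂.tail
      exact absurd (h₃.subset (by simp)) hB

/-- If a filter kills every block but the one indexed by `k`, then filtering the concatenation of
the blocks amounts to filtering the block of `k`. -/
theorem filter_flatten_map_eq {ι α : Type*} {P : α → Bool} {f : ι → List α} {k : ι}
    {l : List ι} (hl : l.Nodup) (hk : k ∈ l) (hf : ∀ j, j ≠ k → (f j).filter P = []) :
    (l.map f).flatten.filter P = (f k).filter P := by
  have aux : ∀ l' : List ι, k ∉ l' → (l'.map f).flatten.filter P = [] := by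
    intro l' h'
    simp only [List.filter_flatten, List.map_map, List.flatten_eq_nil_iff, List.mem_map,
      Function.comp_apply]
    rintro _ ⟨j, hj, rfl⟩
    exact hf j fun e => h' (e ▸ hj)
  induction l with
  | nil => simp at hk
  | cons j l ih =>
    rw [List.nodup_cons] at hl
    simp only [List.map_cons, List.flatten_cons, List.filter_append]
    by_cases hj : j = k
    · subst hj
      rw [aux l hl.1, List.append_nil]
    · rw [hf j hj, List.nil_append]
      exact ih hl.2 ((List.mem_cons.1 hk).resolve_left (Ne.symm hj))

theorem pairwise_truthA {m n : ℕ} (C : Fin n → Clause m) (u : Fin m) (i j : Fin n) :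
    (truthA C).Pairwise fun s s' => ¬(s = some (u, j, false) ∧ s' = some (u, i, true)) := by
  rw [truthA, List.pairwise_flatten, List.pairwise_map]
  refine ⟨?_, (List.nodup_finRange m).imp ?_⟩
  · simp only [List.mem_map]
    rintro _ ⟨v, -, rfl⟩
    rw [vblockA, List.pairwise_append, List.pairwise_map, List.pairwise_map]
    exact ⟨List.pairwise_of_forall (by simp), List.pairwise_of_forall (by simp), by simp⟩
  · intro v w hvw s hs s' hs'
    rintro ⟨rfl, rfl⟩
    simp only [vblockA, List.mem_append, List.mem_map] at hs hs'
    grind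

theorem pairwise_truthB {m n : ℕ} (C : Fin n → Clause m) (u : Fin m) (i j : Fin n) :
    (truthB C).Pairwise fun s s' => ¬(s = some (u, i, true) ∧ s' = some (u, j, false)) := by
  rw [truthB, List.pairwise_flatten, List.pairwise_map]
  refine ⟨?_, (List.nodup_finRange m).imp ?_⟩
  · simp only [List.mem_map]
    rintro _ ⟨v, -, rfl⟩
    rw [vblockB, List.pairwise_append, List.pairwise_map, List.pairwise_map]
    exact ⟨List.pairwise_of_forall (by simp), List.pairwise_of_forall (by simp), by simp⟩
  · intro v w hvw s hs s' hs'
    rintro ⟨rfl, rfl⟩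
    simp only [vblockB, List.mem_append, List.mem_map] at hs hs'
    grind

/-- A common subsequence of the truth-setting parts does not contain both a symbol `u^i` and a
symbol `ū^j`. -/
theorem not_mem_of_sublist_truth {m n : ℕ} {C : Fin n → Clause m} {q : List (Symb m n)}
    (hA : q.Sublist (truthA C)) (hB : q.Sublist (truthB C)) {u : Fin m} {i j : Fin n}
    (hi : some (u, i, true) ∈ q) : some (u, j, false) ∉ q := by
  intro hj
  have h := ((pairwise_truthA C u i j).sublist hA).and ((pairwise_truthB C u i j).sublist hB)
  have : Std.Symm fun s s' : Symb m n => ¬(s = some (u, j, false) ∧ s' = some (u, i, true)) ∧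
      ¬(s = some (u, i, true) ∧ s' = some (u, j, false)) :=
    ⟨fun _ _ hs => ⟨fun e => hs.2 e.symm, fun e => hs.1 e.symm⟩⟩
  exact (h.forall hi hj (by simp)).2 ⟨rfl, rfl⟩

/-- A common subsequence of the satisfaction-testing parts does not contain all three symbols
`x̄^i`, `ȳ^i`, `z̄^i` of a clause `c_i = {x, y, z}`. -/
theorem not_all_mem_of_sublist_test {m n : ℕ} {C : Fin n → Clause m} (hC : ThreeDistinct C)
    {r : List (Symb m n)} (hA : r.Sublist (testA C)) (hB : r.Sublist (testB C)) (i : Fin n) :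
    ¬(litSymBar i (C i).1 ∈ r ∧ litSymBar i (C i).2.1 ∈ r ∧ litSymBar i (C i).2.2 ∈ r) := by
  rintro ⟨hx, hy, hz⟩
  obtain ⟨hxy, hxz, hyz⟩ := hC i
  set L : List (Symb m n) :=
    [litSymBar i (C i).1, litSymBar i (C i).2.1, litSymBar i (C i).2.2] with hL
  have hfA : (testA C).filter (fun s => decide (s ∈ L)) = L := by
    rw [testA, filter_flatten_map_eq (List.nodup_finRange n) (List.mem_finRange i)]
    · simp [cblockA, hL, litSym, litSymBar, hxy, hxz, hyz, hxy.symm, hxz.symm,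
        hyz.symm]
    · intro j hj
      simp [cblockA, hL, litSym, litSymBar, hj]
  have hfB : (testB C).filter (fun s => decide (s ∈ L)) =
      [litSymBar i (C i).2.1, litSymBar i (C i).1, litSymBar i (C i).2.2,
        litSymBar i (C i).2.1] := by
    rw [testB, filter_flatten_map_eq (List.nodup_finRange n) (List.mem_finRange i)]
    · simp [cblockB, hL, litSym, litSymBar, hxy, hxz, hyz, hxy.symm, hxz.symm,
        hyz.symm]
    · intro j hj
      simp [cblockB, hL, litSym, litSymBar, hj]
  have hnd : L.Nodup := by
    simp [hL, litSymBar, hxy, hxz, hyz]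
  have hsub : L ⊆ r.filter (fun s => decide (s ∈ L)) := by
    intro s hs
    refine List.mem_filter.2 ⟨?_, by simpa using hs⟩
    simp only [hL, List.mem_cons, List.not_mem_nil, or_false] at hs
    rcases hs with rfl | rfl | rfl <;> assumption
  have hrA : (r.filter (fun s => decide (s ∈ L))).Sublist L := by
    simpa only [hfA] using hA.filter (fun s => decide (s ∈ L))
  have hrL := hrA.eq_of_length_le (hnd.subperm hsub).length_le
  have hrB := hB.filter (fun s => decide (s ∈ L))
  rw [hrL, hfB, hL] at hrB
  simp [List.cons_sublist_cons', litSymBar, hxy, hyz] at hrB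

/-- second direction of Theorem 2 of the paper.
If there exists a permutation of the alphabet `Σ` of the reduction which is a common
subsequence of the constructed strings `a` and `b`, then the 3SAT instance `C` (with
exactly three literals, on pairwise distinct variables, per clause) has a satisfying
truth assignment. -/
theorem common_permutation_implies_satisfiable (m n : ℕ) (C : Fin n → Clause m)
    (hC : ThreeDistinct C)
    (hperm : ∃ p : List (Symb m n),
      IsPermOfSigma C p ∧ p.Sublist (strA C) ∧ p.Sublist (strB C)) :
    ∃ t : Fin m → Bool, Satisfies t C := by
  classical
  obtain ⟨p, ⟨-, hmem⟩, hpA, hpB⟩ := hperm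
  obtain ⟨q, r, rfl⟩ := List.append_of_mem ((hmem none).2 trivial)
  rw [strA, List.append_assoc, List.singleton_append] at hpA
  rw [strB, List.append_assoc, List.singleton_append] at hpB
  obtain ⟨hqA, hrA⟩ := sublist_split (by simp [truthA, vblockA])
    (by simp [testA, cblockA, litSym, litSymBar]) hpA
  obtain ⟨hqB, hrB⟩ := sublist_split (by simp [truthB, vblockB])
    (by simp [testB, cblockB, litSym, litSymBar]) hpB
  have key : ∀ (i : Fin n) (l : Lit m), litSymBar i l ∈ q →
      LitTrue (fun u => !decide (∃ j : Fin n, some (u, j, true) ∈ q)) l := by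
    rintro i ⟨u, _ | _⟩ h
    · simpa [LitTrue] using ⟨i, h⟩
    · simpa [LitTrue] using fun j hj => not_mem_of_sublist_truth hqA hqB hj h
  refine ⟨fun u => !decide (∃ j : Fin n, some (u, j, true) ∈ q), fun i => ?_⟩
  have hsplit : ∀ l : Lit m, OccursIn C l.1 i → litSymBar i l ∉ q → litSymBar i l ∈ r := by
    intro l hl hq
    have h := (hmem (litSymBar i l)).2 hl
    simp only [List.mem_append, List.mem_cons, hq, false_or] at h
    exact h.resolve_left (by simp [litSymBar])
  by_contra hns
  simp only [not_or] at hns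
  exact not_all_mem_of_sublist_test hC hrA hrB i
    ⟨hsplit _ (.inl rfl) (mt (key i _) hns.1), hsplit _ (.inr (.inl rfl)) (mt (key i _) hns.2.1),
      hsplit _ (.inr (.inr rfl)) (mt (key i _) hns.2.2)⟩

end CommonPerm
end

section
/- In the reduction construction from a 3SAT instance (U, C) to strings a and b over the alphabet Σ (truth-setting variable blocks, boundary symbol •, clause blocks x^i y^i z^i x̄^i ȳ^i z̄^i in a versus x^i y^i z^i ȳ^i x̄^i z̄^i ȳ^i in b), every common subsequence of a and b that is a permutation of Σ decomposes as p₁ · • · p₂, where p₁ is a common subsequence of the truth-setting parts of a and b (the portions before •) and p₂ is a common subsequence of the satisfaction-testing parts (the portions after •), and each non-boundary symbol of Σ occurs in exactly one of p₁, p₂. -/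
namespace CommonPerm

theorem sublist_of_append_singleton_append {α : Type*} {x : α} {l₁ l₂ A B : List α}
    (hA : x ∉ A) (hB : x ∉ B)
    (h : (l₁ ++ [x] ++ l₂).Sublist (A ++ [x] ++ B)) :
    l₁.Sublist A ∧ l₂.Sublist B := by
  obtain ⟨q, s₂, hq, hqA, hs₂⟩ := List.sublist_append_iff.1 h
  obtain ⟨s₁, t, rfl, hs₁, ht⟩ := List.sublist_append_iff.1 hqA
  have hx₁ : x ∉ s₁ := fun hx => hA (hs₁.subset hx)
  have hx₂ : x ∉ s₂ := fun hx => hB (hs₂.subset hx)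
  rcases List.sublist_singleton.1 ht with rfl | rfl
  · have hx : x ∈ l₁ ++ [x] ++ l₂ := by simp
    rw [hq] at hx
    simp [hx₁, hx₂] at hx
  · have heq : s₁ ++ x :: s₂ = l₁ ++ x :: l₂ := by simpa using hq.symm
    obtain ⟨rfl, -, rfl⟩ := (List.append_cons_inj_of_notMem hx₁ hx₂).1 heq
    exact ⟨hs₁, hs₂⟩

theorem none_notMem_truthA {m n : ℕ} (C : Fin n → Clause m) : none ∉ truthA C := by
  simp [truthA, vblockA]

theorem none_notMem_truthB {m n : ℕ} (C : Fin n → Clause m) : none ∉ truthB C := by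
  simp [truthB, vblockB]

theorem none_notMem_testA {m n : ℕ} (C : Fin n → Clause m) : none ∉ testA C := by
  simp [testA, cblockA, litSym, litSymBar]

theorem none_notMem_testB {m n : ℕ} (C : Fin n → Clause m) : none ∉ testB C := by
  simp [testB, cblockB, litSym, litSymBar]

/-- Every common subsequence of `a` and `b` which is a permutation of
`Σ` decomposes as `p₁ · • · p₂` where `p₁` is a common subsequence of the truth-setting
parts of `a` and `b`, `p₂` is a common subsequence of the satisfaction-testing parts,
and every non-boundary symbol of `Σ` occurs in exactly one of `p₁`, `p₂`. -/
theorem perm_decomposes_at_boundary (m n : ℕ) (C : Fin n → Clause m)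
    (hC : ThreeDistinct C) (p : List (Symb m n)) (hperm : IsPermOfSigma C p)
    (hpa : p.Sublist (strA C)) (hpb : p.Sublist (strB C)) :
    ∃ p₁ p₂ : List (Symb m n),
      p = p₁ ++ [none] ++ p₂ ∧
      p₁.Sublist (truthA C) ∧ p₁.Sublist (truthB C) ∧
      p₂.Sublist (testA C) ∧ p₂.Sublist (testB C) ∧
      ∀ s : Symb m n, InSigma C s → s ≠ none → Xor' (s ∈ p₁) (s ∈ p₂) := by
  obtain ⟨hnodup, hmem⟩ := hperm
  obtain ⟨p₁, p₂, rfl⟩ : ∃ p₁ p₂, p = p₁ ++ [none] ++ p₂ := by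
    simpa using List.append_of_mem ((hmem none).2 trivial)
  have hdisj : p₁.Disjoint p₂ := by
    rw [List.append_assoc] at hnodup
    exact (List.disjoint_append_right.1 (List.disjoint_of_nodup_append hnodup)).2
  obtain ⟨hA₁, hA₂⟩ :=
    sublist_of_append_singleton_append (none_notMem_truthA C) (none_notMem_testA C) hpa
  obtain ⟨hB₁, hB₂⟩ :=
    sublist_of_append_singleton_append (none_notMem_truthB C) (none_notMem_testB C) hpb
  refine ⟨p₁, p₂, rfl, hA₁, hB₁, hA₂, hB₂, fun s hs hne => ?_⟩
  have hsp : s ∈ p₁ ∨ s ∈ p₂ := by simpa [hne] using (hmem s).2 hs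
  exact hsp.imp (fun h => ⟨h, fun h' => hdisj h h'⟩) (fun h => ⟨h, fun h' => hdisj h' h⟩)

end CommonPerm
end

section
/- Let x, y, z, x̄, ȳ, z̄, α, β, γ be nine pairwise distinct symbols. Consider the strings A = x̄ x α β y ȳ α γ β z̄ γ z and B = x α x̄ ȳ β y γ α β γ z z̄. Then no common subsequence of A and B in which no symbol occurs more than once contains all six of the symbols x̄, ȳ, z̄, α, β, γ. -/
/-- The claim with `x̄, ȳ, z̄, α, β, γ` numbered `3, …, 8` and `x, y, z` deleted from both strings. -/
theorem not_nodup_of_mem_sublists_of_sublist :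
    ∀ c ∈ [3, 6, 7, 4, 6, 8, 7, 5, 8].sublists,
      (3 ∈ c ∧ 4 ∈ c ∧ 5 ∈ c ∧ 6 ∈ c ∧ 7 ∈ c ∧ 8 ∈ c) →
        c.Sublist [6, 3, 4, 7, 8, 6, 7, 8, 5] → ¬ c.Nodup := by
  decide +kernel

/-- For nine pairwise distinct symbols `x, y, z, x̄, ȳ, z̄, α, β, γ`
and the strings `A = x̄ x α β y ȳ α γ β z̄ γ z`, `B = x α x̄ ȳ β y γ α β γ z z̄`,
no common subsequence of `A` and `B` with no repeated symbols contains all six of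
`x̄, ȳ, z̄, α, β, γ`. -/
theorem corollary_block_blocks_all_negated {σ : Type*} (x y z xb yb zb α β γ : σ)
    (hdist : ([x, y, z, xb, yb, zb, α, β, γ] : List σ).Nodup)
    (c : List σ)
    (hA : c.Sublist [xb, x, α, β, y, yb, α, γ, β, zb, γ, z])
    (hB : c.Sublist [x, α, xb, yb, β, y, γ, α, β, γ, z, zb])
    (hnodup : c.Nodup) :
    ¬ (xb ∈ c ∧ yb ∈ c ∧ zb ∈ c ∧ α ∈ c ∧ β ∈ c ∧ γ ∈ c) := by
  classical
  rintro ⟨hxb, hyb, hzb, hα, hβ, hγ⟩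
  have hmem : ∀ a ∈ c, a ∈ [x, y, z, xb, yb, zb, α, β, γ] := fun a ha => by
    have := hA.subset ha
    simp only [List.mem_cons, List.not_mem_nil, or_false] at this ⊢
    tauto
  let f : σ → ℕ := fun a => [x, y, z, xb, yb, zb, α, β, γ].idxOf a
  have hf : ∀ (i : ℕ) (hi : i < 9), f ([x, y, z, xb, yb, zb, α, β, γ][i]) = i :=
    fun i hi => hdist.idxOf_getElem i hi
  have hx : f x = 0 := hf 0 (by decide)
  have hy : f y = 1 := hf 1 (by decide)
  have hz : f z = 2 := hf 2 (by decide)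
  have hxb' : f xb = 3 := hf 3 (by decide)
  have hyb' : f yb = 4 := hf 4 (by decide)
  have hzb' : f zb = 5 := hf 5 (by decide)
  have hα' : f α = 6 := hf 6 (by decide)
  have hβ' : f β = 7 := hf 7 (by decide)
  have hγ' : f γ = 8 := hf 8 (by decide)
  have hfA := (hA.map f).filter (3 ≤ ·)
  have hfB := (hB.map f).filter (3 ≤ ·)
  simp only [List.map_cons, List.map_nil, hx, hy, hz, hxb', hyb', hzb', hα', hβ', hγ'] at hfA hfB
  refine not_nodup_of_mem_sublists_of_sublist _ (List.mem_sublists.2 hfA) ?_ hfB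
    ((hnodup.map_on fun a ha b _ h => (List.idxOf_inj (hmem a ha)).1 h).filter _)
  have hfc : ∀ {a : σ} {i : ℕ}, a ∈ c → f a = i → 3 ≤ i → i ∈ (c.map f).filter (3 ≤ ·) :=
    fun ha hi h => List.mem_filter.2 ⟨List.mem_map.2 ⟨_, ha, hi⟩, decide_eq_true h⟩
  exact ⟨hfc hxb hxb' (by decide), hfc hyb hyb' (by decide), hfc hzb hzb' (by decide),
    hfc hα hα' (by decide), hfc hβ hβ' (by decide), hfc hγ hγ' (by decide)⟩
end

section
/- Let x, y, z, x̄, ȳ, z̄, α, β, γ be nine pairwise distinct symbols, and consider the strings A = x̄ x α β y ȳ α γ β z̄ γ z and B = x α x̄ ȳ β y γ α β γ z z̄. For every nonempty subset S ⊆ {x, y, z}, there exists a common subsequence of A and B with no repeated symbols that contains all three of α, β, γ and, for each of the three coordinates, contains the positive symbol (x, y, or z) if that coordinate is in S and the barred symbol (x̄, ȳ, or z̄) if it is not. -/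
/-- For nine pairwise distinct symbols `x, y, z, x̄, ȳ, z̄, α, β, γ`
and the strings `A = x̄ x α β y ȳ α γ β z̄ γ z`, `B = x α x̄ ȳ β y γ α β γ z z̄`:
for every nonempty subset `S` of the three coordinates (encoded as `S : Fin 3 → Bool`,
not identically `false`), there is a common subsequence of `A` and `B` with no repeated
symbols which contains all three of `α, β, γ` and, in each coordinate, the positive
symbol if that coordinate lies in `S` and the barred symbol otherwise. -/
theorem corollary_block_admits_all_satisfying {σ : Type*} (x y z xb yb zb α β γ : σ)
    (hdist : ([x, y, z, xb, yb, zb, α, β, γ] : List σ).Nodup)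
    (S : Fin 3 → Bool) (hS : ∃ k, S k = true) :
    ∃ c : List σ,
      c.Sublist [xb, x, α, β, y, yb, α, γ, β, zb, γ, z] ∧
      c.Sublist [x, α, xb, yb, β, y, γ, α, β, γ, z, zb] ∧
      c.Nodup ∧
      α ∈ c ∧ β ∈ c ∧ γ ∈ c ∧
      (if S 0 = true then x else xb) ∈ c ∧
      (if S 1 = true then y else yb) ∈ c ∧
      (if S 2 = true then z else zb) ∈ c := by
  classical
  have h_pairs : ([x, xb, y, yb, z, zb, α, β, γ] : List σ).Nodup := by
    refine (List.Perm.nodup_iff ?_).mp hdist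
    rw [List.perm_iff_count]; intro a; simp only [List.count_cons]; omega
  have h_perm : ∀ c : List σ, ∀ p q r : σ, p = x ∨ p = xb → q = y ∨ q = yb → r = z ∨ r = zb →
      c.Perm [p, q, r, α, β, γ] →
      c.Nodup ∧ α ∈ c ∧ β ∈ c ∧ γ ∈ c ∧ p ∈ c ∧ q ∈ c ∧ r ∈ c := by
    intro c p q r hp hq hr hc
    refine ⟨hc.nodup_iff.mpr ?_, ?_⟩
    · refine List.Nodup.sublist ?_ h_pairs
      change ([p] ++ ([q] ++ ([r] ++ [α, β, γ]))).Sublist ([x, xb] ++ ([y, yb] ++ ([z, zb] ++ _)))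
      refine .append ?_ (.append ?_ (.append ?_ (.refl _))) <;> simpa
    · simp [hc.mem_iff]
  have h_true : S 0 = true ∨ S 1 = true ∨ S 2 = true := by
    simpa [Fin.exists_fin_succ] using hS
  suffices h : ∃ c : List σ,
      c.Sublist [xb, x, α, β, y, yb, α, γ, β, zb, γ, z] ∧
      c.Sublist [x, α, xb, yb, β, y, γ, α, β, γ, z, zb] ∧
      c.Perm [if S 0 = true then x else xb, if S 1 = true then y else yb,
        if S 2 = true then z else zb, α, β, γ] by
    obtain ⟨c, hA, hB, hc⟩ := h
    exact ⟨c, hA, hB, h_perm c _ _ _ (ite_eq_or_eq ..) (ite_eq_or_eq ..) (ite_eq_or_eq ..) hc⟩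
  cases h0 : S 0 <;> cases h1 : S 1 <;> cases h2 : S 2 <;>
    simp only [h0, h1, h2, Bool.false_eq_true, or_self, if_true, if_false] at h_true ⊢
  on_goal 1 => refine ⟨[xb, yb, α, β, γ, z], ?_, ?_, ?_⟩
  on_goal 4 => refine ⟨[xb, β, y, α, γ, zb], ?_, ?_, ?_⟩
  on_goal 7 => refine ⟨[xb, β, y, α, γ, z], ?_, ?_, ?_⟩
  on_goal 10 => refine ⟨[x, α, yb, γ, β, zb], ?_, ?_, ?_⟩
  on_goal 13 => refine ⟨[x, α, yb, γ, β, z], ?_, ?_, ?_⟩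
  on_goal 16 => refine ⟨[x, α, β, y, γ, zb], ?_, ?_, ?_⟩
  on_goal 19 => refine ⟨[x, α, β, y, γ, z], ?_, ?_, ?_⟩
  all_goals first
    | repeat first
        | exact List.nil_sublist _
        | apply List.Sublist.cons_cons
        | apply List.Sublist.cons
      done
    | rw [List.perm_iff_count]; intro a; simp only [List.count_cons]; omega
end
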